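/- Let θ ∈ (0, π/10]. If q is an action minimizer of A over P(Q_S, Q_{E₁}) such that q₁(0) = q₂(0) and q has no collision at t = 1, then its action satisfies A(q) ≥ (3/8)·16^{1/3}·[ (2π²)^{1/3} + 2·(2θ)^{2/3} ]. -/

import Mathlib

open Real MeasureTheory Set
open scoped ENNReal

noncomputable section

/-- Euclidean norm on `ℝ × ℝ` (row vectors in the plane). -/
def enorm2 (v : ℝ × ℝ) : ℝ := Real.sqrt (v.1 ^ 2 + v.2 ^ 2)

/-- Row vector multiplied on the right by the rotation matrix `R θ`
with rows `(cos θ, sin θ)` and `(-sin θ, cos θ)`. -/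
def rotV (θ : ℝ) (v : ℝ × ℝ) : ℝ × ℝ :=
  (v.1 * Real.cos θ - v.2 * Real.sin θ, v.1 * Real.sin θ + v.2 * Real.cos θ)

/-- `H¹([0,1],(ℝ²)⁴)`: absolutely continuous paths `[0,1] → (ℝ²)⁴` with
square-integrable derivative, recorded via an integrable (a.e.-)derivative `v`
together with the integral representation of `q`. -/
structure H1Path4 where
  q : ℝ → Fin 4 → ℝ × ℝ
  v : ℝ → Fin 4 → ℝ × ℝ
  hvInt : ∀ i : Fin 4, IntegrableOn (fun t => v t i) (Icc (0:ℝ) 1)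
  hrep : ∀ i : Fin 4, ∀ t ∈ Icc (0:ℝ) 1, q t i = q 0 i + ∫ s in (0:ℝ)..t, v s i
  hL2 : ∀ i : Fin 4, IntegrableOn (fun t => enorm2 (v t i) ^ 2) (Icc (0:ℝ) 1)

/-- Center of mass at the origin throughout `[0,1]` (the path lies in `χ`). -/
def H1Path4.inChi (p : H1Path4) : Prop := ∀ t ∈ Icc (0:ℝ) 1, ∑ i, p.q t i = 0

/-- The Lagrangian action functional `A`, with value `+∞` allowed. -/
def action (p : H1Path4) : ℝ≥0∞ :=
  ∫⁻ t in Icc (0:ℝ) 1,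
    (ENNReal.ofReal ((1/2) * ∑ i, enorm2 (p.v t i) ^ 2)
      + ∑ i : Fin 4, ∑ j ∈ Finset.univ.filter (fun j => i < j),
          (ENNReal.ofReal (enorm2 (p.q t i - p.q t j)))⁻¹)

/-- The starting boundary configuration set `Q_S` (double isosceles with order
constraints). -/
def QSset : Set (Fin 4 → ℝ × ℝ) :=
  { c | ∃ a₁ b₁ c₁ : ℝ, 0 ≤ b₁ ∧ 0 ≤ c₁ ∧
      c = ![(-a₁ - c₁, 0), (-a₁, 0), ((2*a₁ + c₁)/2, b₁), ((2*a₁ + c₁)/2, -b₁)] }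

/-- The ending boundary configuration set `Q_{E₁}`. -/
def QE1set (θ : ℝ) : Set (Fin 4 → ℝ × ℝ) :=
  { c | ∃ a₂ b₂ c₂ : ℝ, 0 ≤ b₂ ∧ 0 ≤ c₂ ∧
      c = fun i => rotV θ (![(-b₂, -a₂), (-c₂, a₂), (c₂, a₂), (b₂, -a₂)] i) }

/-- The ending boundary configuration set `Q_{E₂}`. -/
def QE2set (θ : ℝ) : Set (Fin 4 → ℝ × ℝ) :=
  { c | ∃ a₂ b₂ c₂ : ℝ, 0 ≤ b₂ ∧ 0 ≤ c₂ ∧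
      c = fun i => rotV θ (![(-a₂, -b₂), (-a₂, b₂), (a₂, c₂), (a₂, -c₂)] i) }

/-- Membership in the admissible class `P(Q_S, E)`. -/
def inAdm (E : Set (Fin 4 → ℝ × ℝ)) (p : H1Path4) : Prop :=
  p.inChi ∧ p.q 0 ∈ QSset ∧ p.q 1 ∈ E

/-- `p` is an action minimizer over `P(Q_S, E)`. -/
def isMin (E : Set (Fin 4 → ℝ × ℝ)) (p : H1Path4) : Prop :=
  inAdm E p ∧ ∀ p' : H1Path4, inAdm E p' → action p ≤ action p'

/-- The Newtonian equations of the equal-mass four-body problem, on a set `s`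
of times. -/
def newton (Q : ℝ → Fin 4 → ℝ × ℝ) (s : Set ℝ) : Prop :=
  ∀ i : Fin 4, ∀ t ∈ s,
    deriv (deriv (fun u => Q u i)) t =
      ∑ j ∈ Finset.univ.erase i, (1 / enorm2 (Q t j - Q t i) ^ 3) • (Q t j - Q t i)

open Filter Topology in
theorem AbsolutelyContinuousOnInterval.of_dist_le {f g h : ℝ → ℝ} {a b : ℝ} (K : ℝ)
    (hg : AbsolutelyContinuousOnInterval g a b) (hh : AbsolutelyContinuousOnInterval h a b)
    (hf : ∀ s ∈ uIcc a b, ∀ t ∈ uIcc a b,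
      dist (f s) (f t) ≤ K * (dist (g s) (g t) + dist (h s) (h t))) :
    AbsolutelyContinuousOnInterval f a b := by
  have hlim := (Tendsto.add hg hh).const_mul K
  rw [add_zero, mul_zero] at hlim
  refine squeeze_zero' (Eventually.of_forall fun E => Finset.sum_nonneg fun _ _ => dist_nonneg)
    ?_ hlim
  refine Eventually.filter_mono inf_le_right ?_
  rw [eventually_principal]
  intro E hE
  rw [← Finset.sum_add_distrib, Finset.mul_sum]
  exact Finset.sum_le_sum fun i hi => hf _ (hE.1 i hi).1 _ (hE.1 i hi).2

theorem abs_sqrt_sq_add_sq_sub_le (a b c d : ℝ) :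
    |√(a ^ 2 + b ^ 2) - √(c ^ 2 + d ^ 2)| ≤ |a - c| + |b - d| := by
  have key : ∀ a b c d : ℝ, √(a ^ 2 + b ^ 2) ≤ √(c ^ 2 + d ^ 2) + (|a - c| + |b - d|) := by
    intro a b c d
    have h1 := Real.sqrt_nonneg (c ^ 2 + d ^ 2)
    have h2 : √(c ^ 2 + d ^ 2) ^ 2 = c ^ 2 + d ^ 2 := Real.sq_sqrt (by positivity)
    have hc : |c| ≤ √(c ^ 2 + d ^ 2) := Real.abs_le_sqrt (by nlinarith [sq_nonneg d])
    have hd : |d| ≤ √(c ^ 2 + d ^ 2) := Real.abs_le_sqrt (by nlinarith [sq_nonneg c])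
    have h3 : c * (a - c) ≤ √(c ^ 2 + d ^ 2) * |a - c| :=
      (le_abs_self _).trans (by rw [abs_mul]; gcongr)
    have h4 : d * (b - d) ≤ √(c ^ 2 + d ^ 2) * |b - d| :=
      (le_abs_self _).trans (by rw [abs_mul]; gcongr)
    refine Real.sqrt_le_iff.2 ⟨by positivity, ?_⟩
    nlinarith [sq_abs (a - c), sq_abs (b - d), mul_nonneg (abs_nonneg (a - c)) (abs_nonneg (b - d))]
  rw [abs_le]
  constructor
  · have := key c d a b
    rw [abs_sub_comm c a, abs_sub_comm d b] at this
    linarith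
  · linarith [key a b c d]

/-- A planar path `(x, y)` on `[0, 1]` with a.e. velocity `(u, w)` whose Keplerian action is
finite. -/
structure KeplerPath where
  x : ℝ → ℝ
  y : ℝ → ℝ
  u : ℝ → ℝ
  w : ℝ → ℝ
  hu : IntervalIntegrable u volume 0 1
  hw : IntervalIntegrable w volume 0 1
  hx : ∀ t, x t = x 0 + ∫ s in (0:ℝ)..t, u s
  hy : ∀ t, y t = y 0 + ∫ s in (0:ℝ)..t, w s
  hspeed : IntervalIntegrable (fun t => u t ^ 2 + w t ^ 2) volume 0 1
  hinv : IntervalIntegrable (fun t => (√(x t ^ 2 + y t ^ 2))⁻¹) volume 0 1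
  hne : ∀ᵐ t, t ∈ uIcc (0:ℝ) 1 → √(x t ^ 2 + y t ^ 2) ≠ 0

namespace KeplerPath

variable (P : KeplerPath)

/-- Distance to the origin. -/
def r (t : ℝ) : ℝ := √(P.x t ^ 2 + P.y t ^ 2)

/-- Integral of the squared speed. -/
def kin : ℝ := ∫ t in (0:ℝ)..1, (P.u t ^ 2 + P.w t ^ 2)

/-- Regularized time, the integral of `1 / r`. -/
def sigma (t : ℝ) : ℝ := ∫ s in (0:ℝ)..t, (P.r s)⁻¹

theorem r_nonneg (t : ℝ) : 0 ≤ P.r t := Real.sqrt_nonneg _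

theorem r_sq (t : ℝ) : P.r t ^ 2 = P.x t ^ 2 + P.y t ^ 2 := Real.sq_sqrt (by positivity)

theorem intervalIntegrable_inv_r : IntervalIntegrable (fun t => (P.r t)⁻¹) volume 0 1 := P.hinv

theorem sigma_zero : P.sigma 0 = 0 := intervalIntegral.integral_same

theorem sigma_mem {t : ℝ} (ht : t ∈ Icc (0:ℝ) 1) : P.sigma t ∈ Icc 0 (P.sigma 1) := by
  refine ⟨intervalIntegral.integral_nonneg ht.1 fun s _ => inv_nonneg.2 (P.r_nonneg s), ?_⟩
  exact intervalIntegral.integral_mono_interval le_rfl ht.1 ht.2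
    (Filter.Eventually.of_forall fun s => inv_nonneg.2 (P.r_nonneg s)) P.intervalIntegrable_inv_r

theorem sigma_one_pos : 0 < P.sigma 1 := by
  refine lt_of_le_of_ne (P.sigma_mem ⟨zero_le_one, le_rfl⟩).1 fun h => ?_
  have h0 := (intervalIntegral.integral_eq_zero_iff_of_le_of_nonneg_ae zero_le_one
    (Filter.Eventually.of_forall fun s => inv_nonneg.2 (P.r_nonneg s))
    P.intervalIntegrable_inv_r).1 h.symm
  have h1 : ∀ᵐ t ∂(volume.restrict (Ioc (0:ℝ) 1)), P.r t ≠ 0 := by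
    rw [ae_restrict_iff' measurableSet_Ioc]
    filter_upwards [P.hne] with t ht hm
    exact ht (by rw [uIcc_of_le zero_le_one]; exact Ioc_subset_Icc_self hm)
  have h2 : ∀ᵐ t ∂(volume.restrict (Ioc (0:ℝ) 1)), False := by
    filter_upwards [h0, h1] with t h0 h1
    exact h1 (inv_eq_zero.1 h0)
  rw [Filter.eventually_false_iff_eq_bot, ae_eq_bot, Measure.restrict_eq_zero] at h2
  simp at h2

theorem absolutelyContinuous_x : AbsolutelyContinuousOnInterval P.x 0 1 := by
  refine .of_dist_le 1 (P.hu.absolutelyContinuousOnInterval_intervalIntegral left_mem_uIcc)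
    (P.hu.absolutelyContinuousOnInterval_intervalIntegral left_mem_uIcc) fun s _ t _ => ?_
  rw [P.hx s, P.hx t, dist_add_left, one_mul]
  exact le_add_of_nonneg_right dist_nonneg

theorem absolutelyContinuous_y : AbsolutelyContinuousOnInterval P.y 0 1 := by
  refine .of_dist_le 1 (P.hw.absolutelyContinuousOnInterval_intervalIntegral left_mem_uIcc)
    (P.hw.absolutelyContinuousOnInterval_intervalIntegral left_mem_uIcc) fun s _ t _ => ?_
  rw [P.hy s, P.hy t, dist_add_left, one_mul]
  exact le_add_of_nonneg_right dist_nonneg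

theorem absolutelyContinuous_r : AbsolutelyContinuousOnInterval P.r 0 1 := by
  refine .of_dist_le 1 P.absolutelyContinuous_x P.absolutelyContinuous_y fun s _ t _ => ?_
  rw [one_mul]
  exact abs_sqrt_sq_add_sq_sub_le _ _ _ _

theorem absolutelyContinuous_sigma : AbsolutelyContinuousOnInterval P.sigma 0 1 :=
  P.intervalIntegrable_inv_r.absolutelyContinuousOnInterval_intervalIntegral left_mem_uIcc

theorem ae_hasDerivAt_x : ∀ᵐ t, t ∈ uIcc (0:ℝ) 1 → HasDerivAt P.x (P.u t) t := by
  filter_upwards [P.hu.ae_hasDerivAt_integral] with t ht hm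
  rw [funext P.hx]
  exact (ht hm 0 left_mem_uIcc).const_add _

theorem ae_hasDerivAt_y : ∀ᵐ t, t ∈ uIcc (0:ℝ) 1 → HasDerivAt P.y (P.w t) t := by
  filter_upwards [P.hw.ae_hasDerivAt_integral] with t ht hm
  rw [funext P.hy]
  exact (ht hm 0 left_mem_uIcc).const_add _

theorem ae_hasDerivAt_sigma : ∀ᵐ t, t ∈ uIcc (0:ℝ) 1 → HasDerivAt P.sigma (P.r t)⁻¹ t := by
  filter_upwards [P.intervalIntegrable_inv_r.ae_hasDerivAt_integral] with t ht hm
  exact ht hm 0 left_mem_uIcc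

/-- The pointwise inequality behind the calibration; the difference of the two sides is a sum of
two squares. -/
theorem calibration_pointwise {x y u w r s c e₁ e₂ k : ℝ} (hr : r ≠ 0) (hc : c ≠ 0)
    (hr2 : r ^ 2 = x ^ 2 + y ^ 2) (hsc : s ^ 2 + c ^ 2 = 1) (he : e₁ ^ 2 + e₂ ^ 2 = 1) :
    k * (((u * e₁ + w * e₂ - ((x * u + y * w) / r * s + r * (c * (2 * k * r⁻¹)))) * c -
      (x * e₁ + y * e₂ - r * s) * (-s * (2 * k * r⁻¹))) / c ^ 2) ≤
      (u ^ 2 + w ^ 2) / 4 - k ^ 2 := by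
  obtain ⟨X, rfl⟩ : ∃ X, x = r * X := ⟨x / r, by field_simp⟩
  obtain ⟨Y, rfl⟩ : ∃ Y, y = r * Y := ⟨y / r, by field_simp⟩
  have hXY : X ^ 2 + Y ^ 2 = 1 := by
    have : r ^ 2 * (X ^ 2 + Y ^ 2 - 1) = 0 := by linear_combination -hr2
    rcases mul_eq_zero.1 this with h | h
    · exact absurd h (pow_ne_zero 2 hr)
    · linarith
  have key : (u ^ 2 + w ^ 2) / 4 - k ^ 2 -
      k * (((u * e₁ + w * e₂ - ((r * X * u + r * Y * w) / r * s + r * (c * (2 * k * r⁻¹)))) * c -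
      (r * X * e₁ + r * Y * e₂ - r * s) * (-s * (2 * k * r⁻¹))) / c ^ 2) =
      (u / 2 - k * (e₁ - s * X) / c) ^ 2 + (w / 2 - k * (e₂ - s * Y) / c) ^ 2 := by
    field_simp
    linear_combination (-16 * k ^ 2) * he + (-16 * k ^ 2 * s ^ 2) * hXY + (16 * k ^ 2) * hsc
  nlinarith [sq_nonneg (u / 2 - k * (e₁ - s * X) / c), sq_nonneg (w / 2 - k * (e₂ - s * Y) / c)]

/-- The calibrating function. -/
def calib (e₁ e₂ k α₀ t : ℝ) : ℝ :=
  (P.x t * e₁ + P.y t * e₂ - P.r t * sin (α₀ + 2 * k * P.sigma t)) / cos (α₀ + 2 * k * P.sigma t)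

theorem sq_add_calib_sub_le {e₁ e₂ k α₀ : ℝ} (he : e₁ ^ 2 + e₂ ^ 2 = 1) (hk : 0 ≤ k)
    (h0 : -(π / 2) < α₀) (h1 : α₀ + 2 * k * P.sigma 1 < π / 2) :
    k ^ 2 + k * (P.calib e₁ e₂ k α₀ 1 - P.calib e₁ e₂ k α₀ 0) ≤ P.kin / 4 := by
  set α : ℝ → ℝ := fun t => α₀ + 2 * k * P.sigma t with hα
  have hcpos : ∀ t ∈ uIcc (0:ℝ) 1, 0 < cos (α t) := by
    intro t ht
    rw [uIcc_of_le zero_le_one] at ht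
    have := P.sigma_mem ht
    refine cos_pos_of_mem_Ioo ⟨?_, ?_⟩
    · have : 0 ≤ 2 * k * P.sigma t := mul_nonneg (by positivity) this.1
      simp only [hα]; linarith
    · have : 2 * k * P.sigma t ≤ 2 * k * P.sigma 1 := by gcongr; exact this.2
      simp only [hα]; linarith
  have hαac : AbsolutelyContinuousOnInterval α 0 1 := by
    have := P.absolutelyContinuous_sigma.const_mul (2 * k)
    refine .of_dist_le 1 this this fun s _ t _ => ?_
    simp only [hα, dist_add_left, one_mul]
    exact le_add_of_nonneg_right dist_nonneg
  have hsin : AbsolutelyContinuousOnInterval (fun t => sin (α t)) 0 1 := by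
    refine .of_dist_le 1 hαac hαac fun s _ t _ => ?_
    rw [one_mul]
    exact (by simpa using Real.lipschitzWith_sin.dist_le_mul (α s) (α t) :
      dist (sin (α s)) (sin (α t)) ≤ dist (α s) (α t)).trans
      (le_add_of_nonneg_right dist_nonneg)
  have hcos : AbsolutelyContinuousOnInterval (fun t => cos (α t)) 0 1 := by
    refine .of_dist_le 1 hαac hαac fun s _ t _ => ?_
    rw [one_mul]
    exact (by simpa using Real.lipschitzWith_cos.dist_le_mul (α s) (α t) :
      dist (cos (α s)) (cos (α t)) ≤ dist (α s) (α t)).trans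
      (le_add_of_nonneg_right dist_nonneg)
  obtain ⟨m, hm, hmin⟩ := isCompact_uIcc.exists_isMinOn nonempty_uIcc hcos.continuousOn
  have hcosinv : AbsolutelyContinuousOnInterval (fun t => (cos (α t))⁻¹) 0 1 := by
    refine .of_dist_le ((cos (α m) ^ 2)⁻¹) hcos hcos fun s hs t ht => ?_
    have hs' := hcpos s hs
    have ht' := hcpos t ht
    have hm' := hcpos m hm
    rw [dist_inv_inv₀ hs'.ne' ht'.ne', div_eq_inv_mul]
    gcongr ?_ * ?_
    · gcongr
      rw [Real.norm_of_nonneg hs'.le, Real.norm_of_nonneg ht'.le, sq]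
      exact mul_le_mul (hmin hs) (hmin ht) hm'.le hs'.le
    · exact le_add_of_nonneg_right dist_nonneg
  have hac : AbsolutelyContinuousOnInterval (P.calib e₁ e₂ k α₀) 0 1 := by
    have := (((P.absolutelyContinuous_x.const_mul e₁).add
      (P.absolutelyContinuous_y.const_mul e₂)).sub (P.absolutelyContinuous_r.mul hsin)).mul hcosinv
    convert this using 1
    ext t
    simp only [calib, Pi.mul_apply, Pi.add_apply, Pi.sub_apply, hα]
    ring
  have hder : ∀ᵐ t, t ∈ uIcc (0:ℝ) 1 →
      k * deriv (P.calib e₁ e₂ k α₀) t ≤ (P.u t ^ 2 + P.w t ^ 2) / 4 - k ^ 2 := by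
    filter_upwards [P.ae_hasDerivAt_x, P.ae_hasDerivAt_y, P.ae_hasDerivAt_sigma, P.hne]
      with t hx hy hσ hr ht
    specialize hx ht
    specialize hy ht
    specialize hσ ht
    have hr : P.r t ≠ 0 := hr ht
    have hrd : HasDerivAt P.r ((P.x t * P.u t + P.y t * P.w t) / P.r t) t := by
      have h := ((hx.fun_pow 2).fun_add (hy.fun_pow 2)).sqrt (by
        rw [← P.r_sq t]; exact pow_ne_zero 2 hr)
      refine h.congr_deriv ?_
      change _ / (2 * P.r t) = _
      field_simp
      simp
      ring
    have hαd : HasDerivAt α (2 * k * (P.r t)⁻¹) t := (hσ.const_mul (2 * k)).const_add α₀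
    have hd := (((hx.mul_const e₁).add (hy.mul_const e₂)).sub (hrd.mul hαd.sin)).div hαd.cos
      (hcpos t ht).ne'
    have : deriv (P.calib e₁ e₂ k α₀) t = _ := hd.deriv
    rw [this]
    exact calibration_pointwise hr (hcpos t ht).ne' (P.r_sq t) (sin_sq_add_cos_sq _) he
  have hint := intervalIntegral.integral_mono_ae_restrict (μ := volume) zero_le_one
    (hac.intervalIntegrable_deriv.const_mul k)
    ((P.hspeed.div_const 4).sub (intervalIntegrable_const (c := k ^ 2))) (by
      rw [Filter.EventuallyLE, ae_restrict_iff' measurableSet_Icc]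
      filter_upwards [hder] with t ht hm
      exact ht (by rwa [uIcc_of_le zero_le_one]))
  rw [intervalIntegral.integral_const_mul, hac.integral_deriv_eq_sub,
    intervalIntegral.integral_sub (P.hspeed.div_const 4) intervalIntegrable_const,
    intervalIntegral.integral_div, intervalIntegral.integral_const] at hint
  simp only [sub_zero, one_smul] at hint
  have : P.kin = ∫ t in (0:ℝ)..1, (P.u t ^ 2 + P.w t ^ 2) := rfl
  linarith

/-- A path whose end directions differ by at least `φ` satisfies the sharp bound on
`∫ |v|² · (∫ 1 / r)²`. -/
theorem sq_le_kin_mul_of_angle {ρ₀ ρ₁ β₀ β₁ φ : ℝ} (hρ₀ : 0 ≤ ρ₀) (hρ₁ : 0 ≤ ρ₁)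
    (hx0 : P.x 0 = ρ₀ * cos β₀) (hy0 : P.y 0 = ρ₀ * sin β₀)
    (hx1 : P.x 1 = ρ₁ * cos β₁) (hy1 : P.y 1 = ρ₁ * sin β₁)
    (hφ0 : 0 ≤ φ) (hφπ : φ < π) (hφ : sin (φ / 2) ≤ |sin ((β₁ - β₀) / 2)|) :
    φ ^ 2 ≤ P.kin * P.sigma 1 ^ 2 := by
  have hS := P.sigma_one_pos
  obtain ⟨ε, hε2, hε⟩ : ∃ ε : ℝ, ε ^ 2 = 1 ∧
      ε * sin ((β₁ - β₀) / 2) = |sin ((β₁ - β₀) / 2)| := by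
    rcases le_total 0 (sin ((β₁ - β₀) / 2)) with h | h
    · exact ⟨1, by norm_num, by rw [abs_of_nonneg h, one_mul]⟩
    · exact ⟨-1, by norm_num, by rw [abs_of_nonpos h, neg_one_mul]⟩
  have hr0 : P.r 0 = ρ₀ := by
    rw [r, hx0, hy0, ← Real.sqrt_sq hρ₀]
    congr 1
    rw [Real.sqrt_sq hρ₀]
    linear_combination ρ₀ ^ 2 * sin_sq_add_cos_sq β₀
  have hr1 : P.r 1 = ρ₁ := by
    rw [r, hx1, hy1, ← Real.sqrt_sq hρ₁]
    congr 1
    rw [Real.sqrt_sq hρ₁]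
    linear_combination ρ₁ ^ 2 * sin_sq_add_cos_sq β₁
  set m := (β₀ + β₁) / 2 with hm
  have hα1 : -(φ / 2) + 2 * (φ / (2 * P.sigma 1)) * P.sigma 1 = φ / 2 := by
    field_simp; ring
  have hcos : 0 < cos (φ / 2) := cos_pos_of_mem_Ioo ⟨by linarith, by linarith⟩
  have hmain := P.sq_add_calib_sub_le (e₁ := -(ε * sin m)) (e₂ := ε * cos m)
    (k := φ / (2 * P.sigma 1)) (α₀ := -(φ / 2))
    (by linear_combination hε2 + ε ^ 2 * sin_sq_add_cos_sq m) (by positivity) (by linarith)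
    (by rw [hα1]; linarith)
  have hc0 : P.calib (-(ε * sin m)) (ε * cos m) (φ / (2 * P.sigma 1)) (-(φ / 2)) 0 =
      ρ₀ * (sin (φ / 2) - |sin ((β₁ - β₀) / 2)|) / cos (φ / 2) := by
    have : sin ((β₁ - β₀) / 2) = -(sin β₀ * cos m - cos β₀ * sin m) := by
      rw [← sin_sub, ← sin_neg]; congr 1; rw [hm]; ring
    rw [calib, P.sigma_zero, mul_zero, add_zero, sin_neg, cos_neg, hr0, hx0, hy0, ← hε, this]
    ring
  have hc1 : P.calib (-(ε * sin m)) (ε * cos m) (φ / (2 * P.sigma 1)) (-(φ / 2)) 1 =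
      ρ₁ * (|sin ((β₁ - β₀) / 2)| - sin (φ / 2)) / cos (φ / 2) := by
    have : sin ((β₁ - β₀) / 2) = sin β₁ * cos m - cos β₁ * sin m := by
      rw [← sin_sub]; congr 1; rw [hm]; ring
    rw [calib, hα1, hr1, hx1, hy1, ← hε, this]
    ring
  have h0 : P.calib (-(ε * sin m)) (ε * cos m) (φ / (2 * P.sigma 1)) (-(φ / 2)) 0 ≤ 0 := by
    rw [hc0]
    exact div_nonpos_of_nonpos_of_nonneg
      (mul_nonpos_of_nonneg_of_nonpos hρ₀ (by linarith)) hcos.le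
  have h1 : 0 ≤ P.calib (-(ε * sin m)) (ε * cos m) (φ / (2 * P.sigma 1)) (-(φ / 2)) 1 := by
    rw [hc1]
    exact div_nonneg (mul_nonneg hρ₁ (by linarith)) hcos.le
  have hk : 0 ≤ φ / (2 * P.sigma 1) := by positivity
  have h2 : (φ / (2 * P.sigma 1)) ^ 2 ≤ P.kin / 4 := by
    nlinarith [mul_nonneg hk (sub_nonneg.2 (h0.trans h1))]
  rw [div_pow, div_le_iff₀ (by positivity)] at h2
  linarith

theorem exists_unit (t : ℝ) :
    ∃ e₁ e₂ : ℝ, e₁ ^ 2 + e₂ ^ 2 = 1 ∧ P.x t = P.r t * e₁ ∧ P.y t = P.r t * e₂ := by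
  by_cases h : P.r t = 0
  · have := P.r_sq t
    refine ⟨1, 0, by norm_num, ?_, ?_⟩ <;> nlinarith
  · refine ⟨P.x t / P.r t, P.y t / P.r t, ?_, by field_simp, by field_simp⟩
    rw [div_pow, div_pow, ← add_div, ← P.r_sq t, div_self (pow_ne_zero 2 h)]

theorem neg_r_le {e₁ e₂ : ℝ} (he : e₁ ^ 2 + e₂ ^ 2 = 1) (t : ℝ) :
    -P.r t ≤ P.x t * e₁ + P.y t * e₂ := by
  refine (abs_le.1 (abs_le_of_sq_le_sq ?_ (P.r_nonneg t))).1
  rw [P.r_sq t]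
  nlinarith [sq_nonneg (P.x t * e₂ - P.y t * e₁)]

theorem two_mul_sq_le_of_collision (Q : KeplerPath) (h0 : P.r 0 = 0) (h1 : P.r 1 = Q.r 1) {φ : ℝ}
    (hφ0 : 0 < φ) (hφπ : φ < π) :
    2 * φ ^ 2 ≤ (P.kin + Q.kin) * (P.sigma 1 + Q.sigma 1) ^ 2 := by
  have hP := P.sigma_one_pos
  have hQ := Q.sigma_one_pos
  set k := φ / (2 * (P.sigma 1 + Q.sigma 1)) with hkdef
  have hk : 0 < k := by positivity
  have hkφ : 2 * k * P.sigma 1 + 2 * k * Q.sigma 1 = φ := by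
    rw [hkdef]; field_simp
  have hkP : 0 < 2 * k * P.sigma 1 := by positivity
  have hkQ : 0 < 2 * k * Q.sigma 1 := by positivity
  obtain ⟨e₁, e₂, he, hPx, hPy⟩ := P.exists_unit 1
  obtain ⟨f₁, f₂, hf, hQx, hQy⟩ := Q.exists_unit 0
  have hmP := P.sq_add_calib_sub_le (α₀ := -(φ / 2)) he hk.le (by linarith) (by linarith)
  have hmQ := Q.sq_add_calib_sub_le (e₁ := -f₁) (e₂ := -f₂) (α₀ := -(φ / 2)) (by simpa using hf)
    hk.le (by linarith) (by linarith)
  set α := -(φ / 2) + 2 * k * Q.sigma 1 with hα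
  have hPα : -(φ / 2) + 2 * k * P.sigma 1 = -α := by linarith
  have hcos : 0 < cos (φ / 2) := cos_pos_of_mem_Ioo ⟨by linarith, by linarith⟩
  have hcosα : 0 < cos α := cos_pos_of_mem_Ioo ⟨by linarith, by linarith⟩
  have hP0 : P.calib e₁ e₂ k (-(φ / 2)) 0 = 0 := by
    have := P.r_sq 0
    rw [h0] at this
    have hx : P.x 0 = 0 := by nlinarith
    have hy : P.y 0 = 0 := by nlinarith
    simp [calib, h0, hx, hy]
  have hP1 : P.calib e₁ e₂ k (-(φ / 2)) 1 = Q.r 1 * (1 + sin α) / cos α := by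
    rw [calib, hPα, hPx, hPy, h1, sin_neg, cos_neg]
    congr 1
    linear_combination Q.r 1 * he
  have hQ0 : Q.calib (-f₁) (-f₂) k (-(φ / 2)) 0 ≤ 0 := by
    have : Q.calib (-f₁) (-f₂) k (-(φ / 2)) 0 = Q.r 0 * (sin (φ / 2) - 1) / cos (φ / 2) := by
      rw [calib, Q.sigma_zero, mul_zero, add_zero, sin_neg, cos_neg, hQx, hQy]
      congr 1
      linear_combination -Q.r 0 * hf
    rw [this]
    exact div_nonpos_of_nonpos_of_nonneg (mul_nonpos_of_nonneg_of_nonpos (Q.r_nonneg 0)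
      (by linarith [sin_le_one (φ / 2)])) hcos.le
  have hQ1 : -(Q.r 1 * (1 + sin α) / cos α) ≤ Q.calib (-f₁) (-f₂) k (-(φ / 2)) 1 := by
    rw [calib, ← hα, ← neg_div]
    gcongr
    linarith [Q.neg_r_le (e₁ := -f₁) (e₂ := -f₂) (by simpa using hf) 1]
  have hsum : 2 * k ^ 2 ≤ (P.kin + Q.kin) / 4 := by
    have : 0 ≤ k * ((P.calib e₁ e₂ k (-(φ / 2)) 1 - P.calib e₁ e₂ k (-(φ / 2)) 0) +
        (Q.calib (-f₁) (-f₂) k (-(φ / 2)) 1 - Q.calib (-f₁) (-f₂) k (-(φ / 2)) 0)) :=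
      mul_nonneg hk.le (by linarith only [hP0, hP1, hQ0, hQ1])
    linarith only [this, hmP, hmQ]
  rw [hkdef, div_pow, ← mul_div_assoc, div_le_iff₀ (by positivity)] at hsum
  linarith only [hsum]

/-- A path starting from collision, followed by the time reversal of another one ending at the
same distance, obeys the collision-ejection bound over a doubled time interval. -/
theorem collision_bound (Q : KeplerPath) (h0 : P.r 0 = 0) (h1 : P.r 1 = Q.r 1) :
    2 * π ^ 2 ≤ (P.kin + Q.kin) * (P.sigma 1 + Q.sigma 1) ^ 2 := by
  have key : ∀ φ ∈ Ioo 0 π, 2 * φ ^ 2 ≤ (P.kin + Q.kin) * (P.sigma 1 + Q.sigma 1) ^ 2 :=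
    fun φ hφ => P.two_mul_sq_le_of_collision Q h0 h1 hφ.1 hφ.2
  have hcl : π ∈ closure (Ioo 0 π) := by
    rw [closure_Ioo pi_pos.ne]
    exact ⟨pi_pos.le, le_rfl⟩
  have hclosed : IsClosed {φ : ℝ | 2 * φ ^ 2 ≤ (P.kin + Q.kin) * (P.sigma 1 + Q.sigma 1) ^ 2} :=
    isClosed_le (by fun_prop) continuous_const
  exact hclosed.closure_subset_iff.2 key hcl

end KeplerPath

theorem keplerian_le {c K S : ℝ} (hc : 0 ≤ c) (hS : 0 < S) (h : c ≤ K * S ^ 2) :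
    (3 / 8) * (16:ℝ) ^ ((1:ℝ) / 3) * c ^ ((1:ℝ) / 3) ≤ K / 8 + S := by
  obtain ⟨b, hb, hbc⟩ : ∃ b : ℝ, 0 ≤ b ∧ c = b ^ 3 :=
    ⟨c ^ ((1:ℝ) / 3), by positivity, by rw [← rpow_natCast, ← rpow_mul hc]; norm_num⟩
  obtain ⟨d, hd, hd4⟩ : ∃ d : ℝ, 0 ≤ d ∧ 4 = d ^ 3 :=
    ⟨(4:ℝ) ^ ((1:ℝ) / 3), by positivity, by
      rw [← rpow_natCast, ← rpow_mul (by norm_num)]; norm_num⟩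
  have hroot : ∀ z : ℝ, 0 ≤ z → (z ^ 3) ^ ((1:ℝ) / 3) = z := fun z hz => by
    rw [← rpow_natCast, ← rpow_mul hz]; norm_num
  have h16 : (16:ℝ) = (d ^ 2) ^ 3 := by
    rw [← pow_mul, mul_comm, pow_mul, ← hd4]; norm_num
  rw [hbc, h16, hroot b hb, hroot _ (by positivity)]
  have hK : b ^ 3 / S ^ 2 ≤ K := by
    rw [div_le_iff₀ (by positivity), ← hbc]; exact h
  have hmain : 3 / 8 * d ^ 2 * b ≤ b ^ 3 / S ^ 2 / 8 + S := by
    have : b ^ 3 / S ^ 2 / 8 + S - 3 / 8 * d ^ 2 * b =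
        (b - d * S) ^ 2 * (b + 2 * (d * S)) / (8 * S ^ 2) := by
      field_simp
      linear_combination 2 * S ^ 3 * hd4
    have h2 : 0 ≤ (b - d * S) ^ 2 * (b + 2 * (d * S)) / (8 * S ^ 2) := by positivity
    linarith
  linarith

/-- Splitting of the angle `2θ` between two directions offset by `±u`. -/
theorem exists_angles {θ : ℝ} (hθ0 : 0 < θ) (hθ1 : θ < π / 2) (u : ℝ) :
    ∃ φ ψ : ℝ, (0 ≤ φ ∧ φ < π ∧ sin (φ / 2) ≤ |sin ((θ + u) / 2)|) ∧
      (0 ≤ ψ ∧ ψ < π ∧ sin (ψ / 2) ≤ |sin ((θ - u) / 2)|) ∧ 2 * θ ≤ φ + ψ := by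
  have harc : ∀ z : ℝ, 0 ≤ arcsin |sin z| ∧ arcsin |sin z| ≤ π / 2 ∧
      sin (arcsin |sin z|) = |sin z| ∧ cos (arcsin |sin z|) = |cos z| := fun z => by
    refine ⟨arcsin_nonneg.2 (abs_nonneg _), arcsin_le_pi_div_two _,
      sin_arcsin (by linarith [abs_nonneg (sin z)]) (abs_sin_le_one z), ?_⟩
    rw [cos_arcsin, sq_abs, ← abs_cos_eq_sqrt_one_sub_sin_sq]
  obtain ⟨hp0, hp1, hps, hpc⟩ := harc ((θ + u) / 2)
  obtain ⟨hq0, hq1, hqs, hqc⟩ := harc ((θ - u) / 2)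
  set p := arcsin |sin ((θ + u) / 2)|
  set q := arcsin |sin ((θ - u) / 2)|
  have hsum : θ ≤ p + q := by
    by_contra! hlt
    have h1 : sin (p + q) < sin θ :=
      sin_lt_sin_of_lt_of_le_pi_div_two (by linarith) hθ1.le hlt
    have h2 : sin θ ≤ sin (p + q) := by
      rw [sin_add, hps, hqs, hpc, hqc, ← abs_mul, ← abs_mul]
      have : sin θ = sin ((θ + u) / 2) * cos ((θ - u) / 2) +
          cos ((θ + u) / 2) * sin ((θ - u) / 2) := by
        rw [← sin_add]; congr 1; ring
      rw [this]
      exact add_le_add (le_abs_self _) (le_abs_self _)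
    linarith
  have hsin : ∀ z, 0 ≤ z → z ≤ π / 2 → sin (min (2 * z) (2 * θ) / 2) ≤ sin z := fun z h0 h1 =>
    sin_le_sin_of_le_of_le_pi_div_two
      (by linarith [le_min (by linarith : 0 ≤ 2 * z) (by linarith : 0 ≤ 2 * θ)]) h1
      (by linarith [min_le_left (2 * z) (2 * θ)])
  refine ⟨min (2 * p) (2 * θ), min (2 * q) (2 * θ),
    ⟨le_min (by linarith) (by linarith), by linarith [min_le_right (2 * p) (2 * θ)],
      hps ▸ hsin p hp0 hp1⟩,
    ⟨le_min (by linarith) (by linarith), by linarith [min_le_right (2 * q) (2 * θ)],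
      hqs ▸ hsin q hq0 hq1⟩, ?_⟩
  rcases min_cases (2 * p) (2 * θ) with h | h <;> rcases min_cases (2 * q) (2 * θ) with h' | h' <;>
    linarith

theorem KeplerPath.two_paths_bound {θ : ℝ} (hθ0 : 0 < θ) (hθ1 : θ < π / 2) (P Q : KeplerPath)
    {ρ₀ ρ₁ τ₀ τ₁ β₀ β₁ γ₀ γ₁ : ℝ} (hρ₀ : 0 ≤ ρ₀) (hρ₁ : 0 ≤ ρ₁) (hτ₀ : 0 ≤ τ₀) (hτ₁ : 0 ≤ τ₁)
    (hPx0 : P.x 0 = ρ₀ * cos β₀) (hPy0 : P.y 0 = ρ₀ * sin β₀)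
    (hPx1 : P.x 1 = ρ₁ * cos β₁) (hPy1 : P.y 1 = ρ₁ * sin β₁)
    (hQx0 : Q.x 0 = τ₀ * cos γ₀) (hQy0 : Q.y 0 = τ₀ * sin γ₀)
    (hQx1 : Q.x 1 = τ₁ * cos γ₁) (hQy1 : Q.y 1 = τ₁ * sin γ₁)
    (hsum : β₁ - β₀ + (γ₁ - γ₀) = 2 * θ) :
    (3 / 8) * (16:ℝ) ^ ((1:ℝ) / 3) * (2 * θ) ^ ((2:ℝ) / 3) ≤
      (P.kin / 8 + P.sigma 1) + (Q.kin / 8 + Q.sigma 1) := by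
  obtain ⟨φ, ψ, ⟨hφ0, hφπ, hφ⟩, ⟨hψ0, hψπ, hψ⟩, hφψ⟩ :=
    exists_angles hθ0 hθ1 (β₁ - β₀ - θ)
  rw [show θ + (β₁ - β₀ - θ) = β₁ - β₀ by ring] at hφ
  rw [show θ - (β₁ - β₀ - θ) = γ₁ - γ₀ by linarith] at hψ
  have hP := keplerian_le (sq_nonneg φ) P.sigma_one_pos
    (P.sq_le_kin_mul_of_angle hρ₀ hρ₁ hPx0 hPy0 hPx1 hPy1 hφ0 hφπ hφ)
  have hQ := keplerian_le (sq_nonneg ψ) Q.sigma_one_pos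
    (Q.sq_le_kin_mul_of_angle hτ₀ hτ₁ hQx0 hQy0 hQx1 hQy1 hψ0 hψπ hψ)
  have hpow : ∀ z : ℝ, 0 ≤ z → (z ^ 2) ^ ((1:ℝ) / 3) = z ^ ((2:ℝ) / 3) := fun z hz => by
    rw [← rpow_natCast, ← rpow_mul hz]; norm_num
  rw [hpow φ hφ0] at hP
  rw [hpow ψ hψ0] at hQ
  have h1 : (2 * θ) ^ ((2:ℝ) / 3) ≤ φ ^ ((2:ℝ) / 3) + ψ ^ ((2:ℝ) / 3) :=
    (rpow_le_rpow (by positivity) hφψ (by norm_num)).trans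
      (rpow_add_le_add_rpow hφ0 hψ0 (by norm_num) (by norm_num))
  have h2 : 0 ≤ (3 / 8) * (16:ℝ) ^ ((1:ℝ) / 3) := by positivity
  nlinarith [mul_le_mul_of_nonneg_left h1 h2]

theorem enorm2_sq (v : ℝ × ℝ) : enorm2 v ^ 2 = v.1 ^ 2 + v.2 ^ 2 := Real.sq_sqrt (by positivity)

theorem enorm2_sub_comm (v w : ℝ × ℝ) : enorm2 (v - w) = enorm2 (w - v) := by
  simp only [enorm2, Prod.fst_sub, Prod.snd_sub]
  congr 1
  ring

namespace H1Path4

variable (p : H1Path4)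

theorem intervalIntegrable_fst (i j : Fin 4) :
    IntervalIntegrable (fun t => (p.v t j).1 - (p.v t i).1) volume 0 1 := by
  rw [intervalIntegrable_iff_integrableOn_Icc_of_le zero_le_one]
  exact (p.hvInt j).fst.sub (p.hvInt i).fst

theorem intervalIntegrable_snd (i j : Fin 4) :
    IntervalIntegrable (fun t => (p.v t j).2 - (p.v t i).2) volume 0 1 := by
  rw [intervalIntegrable_iff_integrableOn_Icc_of_le zero_le_one]
  exact (p.hvInt j).snd.sub (p.hvInt i).snd

/-- First coordinate of `q j - q i`, extended beyond `[0, 1]` as a primitive. -/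
def relX (i j : Fin 4) (t : ℝ) : ℝ :=
  ((p.q 0 j).1 - (p.q 0 i).1) + ∫ s in (0:ℝ)..t, ((p.v s j).1 - (p.v s i).1)

/-- Second coordinate of `q j - q i`, extended beyond `[0, 1]` as a primitive. -/
def relY (i j : Fin 4) (t : ℝ) : ℝ :=
  ((p.q 0 j).2 - (p.q 0 i).2) + ∫ s in (0:ℝ)..t, ((p.v s j).2 - (p.v s i).2)

theorem intervalIntegrable_v (i : Fin 4) {t : ℝ} (ht : t ∈ Icc (0:ℝ) 1) :
    IntervalIntegrable (fun s => p.v s i) volume 0 t := by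
  rw [intervalIntegrable_iff_integrableOn_Icc_of_le ht.1]
  exact (p.hvInt i).mono_set (Icc_subset_Icc_right ht.2)

theorem relX_eq (i j : Fin 4) {t : ℝ} (ht : t ∈ Icc (0:ℝ) 1) :
    p.relX i j t = (p.q t j).1 - (p.q t i).1 := by
  have h : ∀ i, (p.q t i).1 = (p.q 0 i).1 + ∫ s in (0:ℝ)..t, (p.v s i).1 := fun i => by
    rw [p.hrep i t ht, Prod.fst_add, intervalIntegral.integral_of_le ht.1,
      intervalIntegral.integral_of_le ht.1, fst_integral (p.intervalIntegrable_v i ht).1]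
  rw [relX, intervalIntegral.integral_sub, h, h]
  · ring
  · rw [intervalIntegrable_iff_integrableOn_Ioc_of_le ht.1]
    exact (p.intervalIntegrable_v j ht).1.fst
  · rw [intervalIntegrable_iff_integrableOn_Ioc_of_le ht.1]
    exact (p.intervalIntegrable_v i ht).1.fst

theorem relY_eq (i j : Fin 4) {t : ℝ} (ht : t ∈ Icc (0:ℝ) 1) :
    p.relY i j t = (p.q t j).2 - (p.q t i).2 := by
  have h : ∀ i, (p.q t i).2 = (p.q 0 i).2 + ∫ s in (0:ℝ)..t, (p.v s i).2 := fun i => by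
    rw [p.hrep i t ht, Prod.snd_add, intervalIntegral.integral_of_le ht.1,
      intervalIntegral.integral_of_le ht.1, snd_integral (p.intervalIntegrable_v i ht).1]
  rw [relY, intervalIntegral.integral_sub, h, h]
  · ring
  · rw [intervalIntegrable_iff_integrableOn_Ioc_of_le ht.1]
    exact (p.intervalIntegrable_v j ht).1.snd
  · rw [intervalIntegrable_iff_integrableOn_Ioc_of_le ht.1]
    exact (p.intervalIntegrable_v i ht).1.snd

theorem sqrt_rel_eq (i j : Fin 4) {t : ℝ} (ht : t ∈ Icc (0:ℝ) 1) :
    √(p.relX i j t ^ 2 + p.relY i j t ^ 2) = enorm2 (p.q t i - p.q t j) := by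
  rw [enorm2_sub_comm, p.relX_eq i j ht, p.relY_eq i j ht]
  rfl

theorem continuousOn_rel (i j : Fin 4) :
    ContinuousOn (fun t => √(p.relX i j t ^ 2 + p.relY i j t ^ 2)) (Icc 0 1) := by
  have hX := intervalIntegral.continuousOn_primitive_interval'
    (p.intervalIntegrable_fst i j) left_mem_uIcc
  have hY := intervalIntegral.continuousOn_primitive_interval'
    (p.intervalIntegrable_snd i j) left_mem_uIcc
  rw [uIcc_of_le zero_le_one] at hX hY
  exact (((continuousOn_const.add hX).pow 2).add ((continuousOn_const.add hY).pow 2)).sqrt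

theorem ae_rel_ne_zero (i j : Fin 4)
    (hfin : ∫⁻ t in Icc (0:ℝ) 1, (ENNReal.ofReal (enorm2 (p.q t i - p.q t j)))⁻¹ ≠ ⊤) :
    ∀ᵐ t ∂(volume.restrict (Icc (0:ℝ) 1)), √(p.relX i j t ^ 2 + p.relY i j t ^ 2) ≠ 0 := by
  have hmeas : AEMeasurable (fun t => (ENNReal.ofReal (enorm2 (p.q t i - p.q t j)))⁻¹)
      (volume.restrict (Icc (0:ℝ) 1)) := by
    refine (((p.continuousOn_rel i j).aemeasurable measurableSet_Icc).ennreal_ofReal.inv).congr ?_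
    refine (ae_restrict_iff' measurableSet_Icc).2 (Filter.Eventually.of_forall fun t ht => ?_)
    simp only [Pi.inv_apply]
    rw [p.sqrt_rel_eq i j ht]
  filter_upwards [ae_lt_top' hmeas hfin, ae_restrict_mem measurableSet_Icc] with t ht hm h0
  rw [p.sqrt_rel_eq i j hm] at h0
  simp [h0] at ht

theorem intervalIntegrable_inv_rel (i j : Fin 4)
    (hfin : ∫⁻ t in Icc (0:ℝ) 1, (ENNReal.ofReal (enorm2 (p.q t i - p.q t j)))⁻¹ ≠ ⊤) :
    IntervalIntegrable (fun t => (√(p.relX i j t ^ 2 + p.relY i j t ^ 2))⁻¹) volume 0 1 := by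
  rw [intervalIntegrable_iff_integrableOn_Icc_of_le zero_le_one]
  refine ⟨((p.continuousOn_rel i j).aemeasurable measurableSet_Icc).inv.aestronglyMeasurable, ?_⟩
  rw [hasFiniteIntegral_iff_ofReal
    (Filter.Eventually.of_forall fun t => inv_nonneg.2 (Real.sqrt_nonneg _))]
  refine lt_of_le_of_lt (lintegral_mono_ae ?_) (lt_top_iff_ne_top.2 hfin)
  filter_upwards [p.ae_rel_ne_zero i j hfin, ae_restrict_mem measurableSet_Icc] with t ht hm
  rw [ENNReal.ofReal_inv_of_pos (lt_of_le_of_ne (Real.sqrt_nonneg _) ht.symm),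
    p.sqrt_rel_eq i j hm]

/-- The relative position `q j - q i` of a pair of bodies with finite potential integral. -/
def pairPath (i j : Fin 4)
    (hfin : ∫⁻ t in Icc (0:ℝ) 1, (ENNReal.ofReal (enorm2 (p.q t i - p.q t j)))⁻¹ ≠ ⊤) :
    KeplerPath where
  x := p.relX i j
  y := p.relY i j
  u t := (p.v t j).1 - (p.v t i).1
  w t := (p.v t j).2 - (p.v t i).2
  hu := p.intervalIntegrable_fst i j
  hw := p.intervalIntegrable_snd i j
  hx t := by simp [relX]
  hy t := by simp [relY]
  hspeed := by
    rw [intervalIntegrable_iff_integrableOn_Icc_of_le zero_le_one]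
    have hu := (p.hvInt j).fst.sub (p.hvInt i).fst
    have hw := (p.hvInt j).snd.sub (p.hvInt i).snd
    refine Integrable.mono' (((p.hL2 i).const_mul 2).add ((p.hL2 j).const_mul 2))
      ((hu.aestronglyMeasurable.pow 2).add (hw.aestronglyMeasurable.pow 2))
      (Filter.Eventually.of_forall fun t => ?_)
    simp only [Pi.add_apply, enorm2_sq]
    rw [Real.norm_of_nonneg (by positivity)]
    nlinarith [sq_nonneg ((p.v t j).1 + (p.v t i).1), sq_nonneg ((p.v t j).2 + (p.v t i).2)]
  hinv := p.intervalIntegrable_inv_rel i j hfin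
  hne := by
    rw [uIcc_of_le zero_le_one]
    exact (ae_restrict_iff' measurableSet_Icc).1 (p.ae_rel_ne_zero i j hfin)

/-- Lower bound density of the action coming from the pair `i, j`. -/
def pairDensity (i j : Fin 4) (t : ℝ) : ℝ :=
  (((p.v t j).1 - (p.v t i).1) ^ 2 + ((p.v t j).2 - (p.v t i).2) ^ 2) / 8 +
    (√(p.relX i j t ^ 2 + p.relY i j t ^ 2))⁻¹

theorem pairDensity_nonneg (i j : Fin 4) (t : ℝ) : 0 ≤ p.pairDensity i j t := by
  unfold pairDensity
  positivity

theorem integrableOn_pairDensity (i j : Fin 4)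
    (hfin : ∫⁻ t in Icc (0:ℝ) 1, (ENNReal.ofReal (enorm2 (p.q t i - p.q t j)))⁻¹ ≠ ⊤) :
    IntegrableOn (p.pairDensity i j) (Icc 0 1) := by
  rw [← intervalIntegrable_iff_integrableOn_Icc_of_le zero_le_one]
  exact ((p.pairPath i j hfin).hspeed.div_const 8).add (p.pairPath i j hfin).hinv

theorem integral_pairDensity (i j : Fin 4)
    (hfin : ∫⁻ t in Icc (0:ℝ) 1, (ENNReal.ofReal (enorm2 (p.q t i - p.q t j)))⁻¹ ≠ ⊤) :
    ∫ t in Icc (0:ℝ) 1, p.pairDensity i j t =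
      (p.pairPath i j hfin).kin / 8 + (p.pairPath i j hfin).sigma 1 := by
  rw [integral_Icc_eq_integral_Ioc, ← intervalIntegral.integral_of_le zero_le_one]
  refine (intervalIntegral.integral_add ((p.pairPath i j hfin).hspeed.div_const 8)
    (p.pairPath i j hfin).hinv).trans ?_
  rw [intervalIntegral.integral_div]
  rfl

theorem action_eq : action p = ∫⁻ t in Icc (0:ℝ) 1,
    (ENNReal.ofReal ((1/2) * ∑ i, enorm2 (p.v t i) ^ 2)
      + ∑ a ∈ Finset.univ.filter (fun a : Fin 4 × Fin 4 => a.1 < a.2),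
          (ENNReal.ofReal (enorm2 (p.q t a.1 - p.q t a.2)))⁻¹) := by
  unfold action
  congr 1
  ext t
  rw [Finset.sum_filter, ← Finset.univ_product_univ, Finset.sum_product]
  simp only [Finset.sum_filter]

theorem potential_ne_top (hA : action p ≠ ⊤) {i j : Fin 4} (hij : i < j) :
    ∫⁻ t in Icc (0:ℝ) 1, (ENNReal.ofReal (enorm2 (p.q t i - p.q t j)))⁻¹ ≠ ⊤ := by
  rw [action_eq] at hA
  refine ne_top_of_le_ne_top hA (lintegral_mono fun t => ?_)
  refine le_add_left ?_
  have hmem : (i, j) ∈ Finset.univ.filter (fun a : Fin 4 × Fin 4 => a.1 < a.2) := by simpa using hij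
  refine le_of_eq_of_le ?_ (Finset.single_le_sum (fun _ _ => bot_le) hmem)
  rfl

theorem sum_pairs {M : Type*} [AddCommMonoid M] (f : Fin 4 × Fin 4 → M) :
    ∑ a ∈ Finset.univ.filter (fun a : Fin 4 × Fin 4 => a.1 < a.2), f a =
      f (0, 1) + f (0, 2) + f (0, 3) + f (1, 2) + f (1, 3) + f (2, 3) := by
  have : Finset.univ.filter (fun a : Fin 4 × Fin 4 => a.1 < a.2) =
      {(0, 1), (0, 2), (0, 3), (1, 2), (1, 3), (2, 3)} := by decide
  rw [this]
  simp [add_assoc]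

theorem ofReal_sum_integral_le_action (hA : action p ≠ ⊤) :
    ENNReal.ofReal (∑ a ∈ Finset.univ.filter (fun a : Fin 4 × Fin 4 => a.1 < a.2),
      ∫ t in Icc (0:ℝ) 1, p.pairDensity a.1 a.2 t) ≤ action p := by
  have hint : ∀ a ∈ Finset.univ.filter (fun a : Fin 4 × Fin 4 => a.1 < a.2),
      IntegrableOn (p.pairDensity a.1 a.2) (Icc 0 1) := fun a ha =>
    p.integrableOn_pairDensity a.1 a.2 (p.potential_ne_top hA (Finset.mem_filter.1 ha).2)
  rw [← integral_finsetSum _ hint, ofReal_integral_eq_lintegral_ofReal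
    (integrable_finsetSum _ hint)
    (Filter.Eventually.of_forall fun t => Finset.sum_nonneg fun a _ => p.pairDensity_nonneg _ _ t),
    action_eq]
  refine setLIntegral_mono' measurableSet_Icc fun t ht => ?_
  simp only [pairDensity, Finset.sum_add_distrib]
  refine ENNReal.ofReal_add_le.trans (add_le_add ?_ ?_)
  · refine ENNReal.ofReal_le_ofReal ?_
    simp only [sum_pairs, Fin.sum_univ_four, enorm2_sq]
    nlinarith [sq_nonneg ((p.v t 0).1 + (p.v t 1).1 + (p.v t 2).1 + (p.v t 3).1),
      sq_nonneg ((p.v t 0).2 + (p.v t 1).2 + (p.v t 2).2 + (p.v t 3).2)]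
  · rw [ENNReal.ofReal_sum_of_nonneg fun a _ => inv_nonneg.2 (Real.sqrt_nonneg _)]
    refine Finset.sum_le_sum fun a _ => ?_
    rw [p.sqrt_rel_eq a.1 a.2 ht]
    have hnn : 0 ≤ enorm2 (p.q t a.1 - p.q t a.2) := Real.sqrt_nonneg _
    rcases hnn.eq_or_lt with h | h
    · simp [← h]
    · rw [ENNReal.ofReal_inv_of_pos h]

end H1Path4

theorem exists_polar (a b : ℝ) : ∃ ρ β : ℝ, 0 ≤ ρ ∧ a = ρ * cos β ∧ b = ρ * sin β :=
  ⟨‖(⟨a, b⟩ : ℂ)‖, Complex.arg ⟨a, b⟩, norm_nonneg _, (Complex.norm_mul_cos_arg ⟨a, b⟩).symm,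
    (Complex.norm_mul_sin_arg ⟨a, b⟩).symm⟩

/-- for `θ ∈ (0, π/10]`, an action minimizer over `P(Q_S, Q_{E₁})`
with `q₁(0) = q₂(0)` and no collision at `t = 1` has action at least
`(3/8)·16^{1/3}·[(2π²)^{1/3} + 2(2θ)^{2/3}]`. -/
theorem statement16 (θ : ℝ) (hθ0 : 0 < θ) (hθ1 : θ ≤ π/10)
    (p : H1Path4) (hp : isMin (QE1set θ) p)
    (hcol : p.q 0 0 = p.q 0 1)
    (hnc1 : ∀ i j : Fin 4, i ≠ j → p.q 1 i ≠ p.q 1 j) :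
    ENNReal.ofReal ((3/8) * (16:ℝ) ^ ((1:ℝ)/3) *
      ((2 * π^2) ^ ((1:ℝ)/3) + 2 * (2*θ) ^ ((2:ℝ)/3))) ≤ action p := by
  by_cases hA : action p = ⊤
  · rw [hA]; exact le_top
  refine le_trans (ENNReal.ofReal_le_ofReal ?_) (p.ofReal_sum_integral_le_action hA)
  have hfin : ∀ {i j : Fin 4}, i < j → _ := fun hij => p.potential_ne_top hA hij
  rw [H1Path4.sum_pairs]
  dsimp only
  rw [p.integral_pairDensity 0 1 (hfin (by decide)), p.integral_pairDensity 0 2 (hfin (by decide)),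
    p.integral_pairDensity 0 3 (hfin (by decide)), p.integral_pairDensity 1 2 (hfin (by decide)),
    p.integral_pairDensity 1 3 (hfin (by decide)), p.integral_pairDensity 2 3 (hfin (by decide))]
  set P01 := p.pairPath 0 1 (hfin (by decide))
  set P02 := p.pairPath 0 2 (hfin (by decide))
  set P03 := p.pairPath 0 3 (hfin (by decide))
  set P12 := p.pairPath 1 2 (hfin (by decide))
  set P13 := p.pairPath 1 3 (hfin (by decide))
  set P23 := p.pairPath 2 3 (hfin (by decide))
  obtain ⟨⟨-, ⟨a₁, b₁, c₁, -, -, hq0⟩, a₂, b₂, c₂, hb₂, hc₂, hq1⟩, -⟩ := hp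
  have hc₁ : c₁ = 0 := by
    rw [hq0] at hcol
    simpa using congrArg Prod.fst hcol
  subst hc₁
  have m0 : (0:ℝ) ∈ Icc (0:ℝ) 1 := ⟨le_rfl, zero_le_one⟩
  have m1 : (1:ℝ) ∈ Icc (0:ℝ) 1 := ⟨zero_le_one, le_rfl⟩
  have hθ2 : θ < π / 2 := by linarith [pi_pos]
  obtain ⟨ρ, β, hρ, hρx, hρy⟩ := exists_polar (2 * a₁) b₁
  obtain ⟨τ, γ, hτ, hτx, hτy⟩ := exists_polar (b₂ + c₂) (2 * a₂)
  have hend : ∀ i j : Fin 4, p.relX i j 1 = (p.q 1 j).1 - (p.q 1 i).1 ∧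
      p.relY i j 1 = (p.q 1 j).2 - (p.q 1 i).2 := fun i j => ⟨p.relX_eq i j m1, p.relY_eq i j m1⟩
  have hstart : ∀ i j : Fin 4, p.relX i j 0 = (p.q 0 j).1 - (p.q 0 i).1 ∧
      p.relY i j 0 = (p.q 0 j).2 - (p.q 0 i).2 := fun i j => ⟨p.relX_eq i j m0, p.relY_eq i j m0⟩
  have hinner := KeplerPath.two_paths_bound hθ0 hθ2 P03 P12 (ρ₀ := ρ) (ρ₁ := 2 * b₂) (τ₀ := ρ)
    (τ₁ := 2 * c₂) (β₀ := -β) (β₁ := θ) (γ₀ := β) (γ₁ := θ) hρ (by positivity) hρ (by positivity)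
    ((hstart 0 3).1.trans (by rw [hq0, cos_neg, ← hρx]; simp; ring))
    ((hstart 0 3).2.trans (by rw [hq0, sin_neg, mul_neg, ← hρy]; simp))
    ((hend 0 3).1.trans (by rw [hq1]; simp [rotV]; ring))
    ((hend 0 3).2.trans (by rw [hq1]; simp [rotV]; ring))
    ((hstart 1 2).1.trans (by rw [hq0, ← hρx]; simp; ring))
    ((hstart 1 2).2.trans (by rw [hq0, ← hρy]; simp))
    ((hend 1 2).1.trans (by rw [hq1]; simp [rotV]; ring))
    ((hend 1 2).2.trans (by rw [hq1]; simp [rotV]; ring))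
    (by ring)
  have houter := KeplerPath.two_paths_bound hθ0 hθ2 P02 P13 (ρ₀ := ρ) (ρ₁ := τ) (τ₀ := ρ)
    (τ₁ := τ) (β₀ := β) (β₁ := θ + γ) (γ₀ := -β) (γ₁ := θ - γ) hρ hτ hρ hτ
    ((hstart 0 2).1.trans (by rw [hq0, ← hρx]; simp; ring))
    ((hstart 0 2).2.trans (by rw [hq0, ← hρy]; simp))
    ((hend 0 2).1.trans (by
      rw [hq1, cos_add]; simp [rotV]; linear_combination cos θ * hτx - sin θ * hτy))
    ((hend 0 2).2.trans (by
      rw [hq1, sin_add]; simp [rotV]; linear_combination sin θ * hτx + cos θ * hτy))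
    ((hstart 1 3).1.trans (by rw [hq0, cos_neg, ← hρx]; simp; ring))
    ((hstart 1 3).2.trans (by rw [hq0, sin_neg, mul_neg, ← hρy]; simp))
    ((hend 1 3).1.trans (by
      rw [hq1, cos_sub]; simp [rotV]; linear_combination cos θ * hτx + sin θ * hτy))
    ((hend 1 3).2.trans (by
      rw [hq1, sin_sub]; simp [rotV]; linear_combination sin θ * hτx - cos θ * hτy))
    (by ring)
  have hr0 : P01.r 0 = 0 := by
    refine (p.sqrt_rel_eq 0 1 m0).trans ?_
    rw [hcol]
    simp [enorm2]
  have hr1 : P01.r 1 = P23.r 1 := by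
    refine (p.sqrt_rel_eq 0 1 m1).trans (Eq.trans ?_ (p.sqrt_rel_eq 2 3 m1).symm)
    rw [hq1, enorm2, enorm2]
    congr 1
    simp [rotV]
    ring_nf
  have hcollision := keplerian_le (by positivity)
    (add_pos P01.sigma_one_pos P23.sigma_one_pos) (P01.collision_bound P23 hr0 hr1)
  linarith

end
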